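/- arXiv:1705.09946 — 4 statements merged into one kernel-verified Lean document; each statement's English description precedes it below -/
import Mathlib

section
/- Let L_1,…,L_d (d ≥ 2) be distinct lines in ℙ² over an algebraically closed field K, and let s be the number of crossing points. If the lines do not all pass through a single common point, then s ≥ d. -/
open scoped BigOperators

theorem dBE_aux {P : Type*} {d : ℕ} (hd : 2 ≤ d) (I : P → Fin d → Prop)
    (hx : ∀ i j, i ≠ j → ∃ p, I p i ∧ I p j)
    (hu : ∀ p q i j, I p i → I q i → I p j → I q j → p = q ∨ i = j)
    (hc : ∀ p, ∃ i, ¬ I p i) :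
    d ≤ Nat.card {p : P | 2 ≤ Nat.card {i : Fin d | I p i}} := by
  classical
  have hS : ∀ p : P, 2 ≤ Nat.card {i : Fin d | I p i} ↔ ∃ i j, i ≠ j ∧ I p i ∧ I p j := by
    intro p
    rw [Nat.card_eq_fintype_card, Nat.succ_le_iff, Fintype.one_lt_card_iff]
    constructor
    · rintro ⟨⟨a, ha⟩, ⟨b, hb⟩, hab⟩
      exact ⟨a, b, fun h => hab (Subtype.ext h), ha, hb⟩
    · rintro ⟨a, b, hab, ha, hb⟩
      exact ⟨⟨a, ha⟩, ⟨b, hb⟩, fun h => hab (congrArg Subtype.val h)⟩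
  simp_rw [hS]
  choose f hf using hx
  have hfin : Finite {p : P | ∃ i j, i ≠ j ∧ I p i ∧ I p j} := by
    have : ∀ p : {p : P | ∃ i j, i ≠ j ∧ I p i ∧ I p j},
        ∃ x : Fin d × Fin d, x.1 ≠ x.2 ∧ I p x.1 ∧ I p x.2 := by
      rintro ⟨p, i, j, h⟩
      exact ⟨(i, j), h⟩
    choose g hg using this
    refine Finite.of_injective g fun p q hpq => Subtype.ext ?_
    have h1 := hg p
    have h2 := hg q
    rw [← hpq] at h2
    exact (hu _ _ _ _ h1.2.1 h2.2.1 h1.2.2 h2.2.2).resolve_right h1.1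
  have := Fintype.ofFinite {p : P | ∃ i j, i ≠ j ∧ I p i ∧ I p j}
  letI m : Membership {p : P | ∃ i j, i ≠ j ∧ I p i ∧ I p j} (Fin d) := ⟨fun i p => I p.1 i⟩
  letI hp : Configuration.HasPoints {p : P | ∃ i j, i ≠ j ∧ I p i ∧ I p j} (Fin d) :=
    { exists_point := by
        intro l
        haveI : Nontrivial (Fin d) := Fin.nontrivial_iff_two_le.2 hd
        obtain ⟨k, hk⟩ := exists_ne l
        obtain ⟨h1, h2⟩ := hf k l hk
        obtain ⟨n, hn⟩ := hc (f k l hk)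
        have hnk : n ≠ k := by rintro rfl; exact hn h1
        obtain ⟨h3, h4⟩ := hf n k hnk
        refine ⟨⟨f n k hnk, n, k, hnk, h3, h4⟩, fun (h : I (f n k hnk) l) => ?_⟩
        have := (hu _ _ _ _ h4 h1 h h2).resolve_right hk
        rw [this] at h3
        exact hn h3
      exists_line := fun p => hc p.1
      eq_or_eq := fun {p q i j} h1 h2 h3 h4 =>
        (hu p.1 q.1 i j h1 h2 h3 h4).imp_left Subtype.ext
      mkPoint := fun {i j} h => ⟨f i j h, i, j, h, hf i j h⟩
      mkPoint_ax := fun {i j} h => hf i j h }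
  have := Configuration.HasPoints.card_le {p : P | ∃ i j, i ≠ j ∧ I p i ∧ I p j} (Fin d)
  rw [Nat.card_eq_fintype_card]
  simpa using this

/-- **Weak de Bruijn–Erdős theorem.** For `d ≥ 2` distinct lines in `ℙ²` over an
algebraically closed field which do not all pass through a single point, the number `s`
of crossing points (points lying on at least two of the lines) satisfies `s ≥ d`.
Lines are encoded by nonzero coefficient vectors `L i` (up to scalar), a projective
point `P` lying on line `i` iff `∑ j, L i j * P.rep j = 0`. -/
theorem deBruijnErdos_weak (K : Type*) [Field K] [IsAlgClosed K]
    (d : ℕ) (hd : 2 ≤ d)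
    (L : Fin d → (Fin 3 → K))
    (hL0 : ∀ i, L i ≠ 0)
    (hLdist : ∀ i j, i ≠ j → ∀ c : K, L i ≠ c • L j)
    (hconc : ¬ ∃ v : Fin 3 → K, v ≠ 0 ∧ ∀ i, ∑ j, L i j * v j = 0) :
    d ≤ Nat.card {P : Projectivization K (Fin 3 → K) |
        2 ≤ Nat.card {i : Fin d | ∑ j, L i j * P.rep j = 0}} := by
  classical
  have hI : ∀ (p : Projectivization K (Fin 3 → K)) i, ∑ j, L i j * p.rep j = 0 ↔
      Projectivization.orthogonal p (Projectivization.mk K (L i) (hL0 i)) := by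
    intro p i
    conv_rhs => rw [← p.mk_rep, Projectivization.orthogonal_comm, Projectivization.orthogonal_mk]
    rfl
  have hne : ∀ i j, i ≠ j →
      Projectivization.mk K (L i) (hL0 i) ≠ Projectivization.mk K (L j) (hL0 j) := by
    intro i j hij h
    rw [Projectivization.mk_eq_mk_iff'] at h
    obtain ⟨a, ha⟩ := h
    exact hLdist i j hij a ha.symm
  refine dBE_aux hd (fun (p : Projectivization K (Fin 3 → K)) i => ∑ j, L i j * p.rep j = 0)
    ?_ ?_ ?_
  · intro i j hij
    simp only [hI]
    exact ⟨_, Projectivization.cross_orthogonal_left (hne i j hij),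
      Projectivization.cross_orthogonal_right (hne i j hij)⟩
  · intro p q i j
    simp only [hI]
    intro h1 h2 h3 h4
    refine (Configuration.ofField.eq_or_eq_of_orthogonal h1 h2 h3 h4).imp_right fun h => ?_
    by_contra hij
    exact hne i j hij h
  · intro p
    by_contra! h
    exact hconc ⟨p.rep, p.rep_nonzero, h⟩
end

section
/- Let Z = m_1p_1+⋯+m_sp_s be a fat point subscheme of ℙ^N. For every integer t ≥ 0, dim_K [I(Z)]_t ≥ max{0, C(t+N,N) − Σ_i C(m_i+N−1,N)}, and equality holds for all t ≥ (Σ_i m_i) − 1, where C(a,b) denotes the binomial coefficient. -/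
open MvPolynomial

noncomputable section

/-- The ideal of polynomials vanishing on the affine cone over the projective point
with homogeneous coordinate vector `p` (i.e. all forms whose homogeneous components
vanish at `p`, for an infinite field). -/
def coneIdeal (K : Type*) [Field K] {n : ℕ} (p : Fin n → K) :
    Ideal (MvPolynomial (Fin n) K) where
  carrier := {f | ∀ t : K, eval (t • p) f = 0}
  add_mem' := by
    intro a b ha hb t
    simp only [Set.mem_setOf_eq] at ha hb ⊢
    simp [map_add, ha t, hb t]
  zero_mem' := by
    intro t
    simp
  smul_mem' := by
    intro c f hf t
    simp only [Set.mem_setOf_eq] at hf ⊢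
    simp [smul_eq_mul, map_mul, hf t]

/-- The degree-`t` homogeneous component of an ideal, as a `K`-vector subspace. -/
def homComp (K : Type*) [Field K] {n : ℕ} (I : Ideal (MvPolynomial (Fin n) K)) (t : ℕ) :
    Submodule K (MvPolynomial (Fin n) K) :=
  (Submodule.restrictScalars K I) ⊓ homogeneousSubmodule (Fin n) K t

/-- `α(I)` : the least degree `t` such that `[I]_t ≠ 0`. -/
def alphaDeg (K : Type*) [Field K] {n : ℕ} (I : Ideal (MvPolynomial (Fin n) K)) : ℕ :=
  sInf {t : ℕ | homComp K I t ≠ ⊥}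

/-- The ideal of the fat point scheme `Z = m_1 p_1 + ⋯ + m_s p_s`. -/
def fatIdeal (K : Type*) [Field K] {n s : ℕ} (p : Fin s → (Fin n → K)) (m : Fin s → ℕ) :
    Ideal (MvPolynomial (Fin n) K) :=
  ⨅ i, (coneIdeal K (p i)) ^ (m i)

/-- The `k`-th symbolic power `I(kZ)` of the fat point ideal. -/
def symbPow (K : Type*) [Field K] {n s : ℕ} (p : Fin s → (Fin n → K)) (m : Fin s → ℕ)
    (k : ℕ) : Ideal (MvPolynomial (Fin n) K) :=
  fatIdeal K p (fun i => k * m i)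

/-- The Waldschmidt constant `α̂(I(Z)) = inf_{k ≥ 1} α(I(kZ))/k`. -/
def waldschmidt (K : Type*) [Field K] {n s : ℕ} (p : Fin s → (Fin n → K)) (m : Fin s → ℕ) :
    ℝ :=
  ⨅ k : ℕ+, (alphaDeg K (symbPow K p m k) : ℝ) / (k : ℝ)

/-- The vectors `p i` represent distinct points of projective space. -/
def ProjDistinct (K : Type*) [Field K] {n s : ℕ} (p : Fin s → (Fin n → K)) : Prop :=
  (∀ i, p i ≠ 0) ∧ ∀ i j, i ≠ j → ∀ c : K, p i ≠ c • p j


lemma finrank_hom_aux (K : Type*) [Field K] (σ : Type*) [Fintype σ] (n : ℕ) :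
    Module.finrank K (homogeneousSubmodule σ K n) = (Fintype.card σ + n - 1).choose n := by
  classical
  have h : homogeneousSubmodule σ K n = restrictSupport K {d : σ →₀ ℕ | d.degree = n} := by
    ext f
    rw [mem_homogeneousSubmodule, mem_restrictSupport_iff]
    simp only [IsHomogeneous, IsWeightedHomogeneous, Set.subset_def, Finset.mem_coe, mem_support_iff,
      Set.mem_ofPred_eq, Finsupp.degree_eq_weight_one]
    exact Iff.rfl
  rw [h, Module.finrank_eq_nat_card_basis (basisRestrictSupport K _),
    ← Sym.card_sym_eq_choose, ← Nat.card_eq_fintype_card]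
  apply Nat.card_congr
  exact ((Sym.equivNatSum σ n).trans (Equiv.subtypeEquivRight (by
    intro x; rw [Set.mem_ofPred_eq, Finsupp.degree_eq_sum, Finsupp.sum_fintype _ _ (by simp)]; rfl))).symm

section pt
variable {K : Type*} [Field K] {n : ℕ} (k : Fin n) (p : Fin n → K)

def cc (i : Fin n) : K := if i = k then 0 else p i / p k

def phi : MvPolynomial (Fin n) K →ₐ[K] MvPolynomial (Fin n) K :=
  aeval (fun i => X i + C (cc k p i) * X k)

def phi' : MvPolynomial (Fin n) K →ₐ[K] MvPolynomial (Fin n) K :=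
  aeval (fun i => X i - C (cc k p i) * X k)

def del : MvPolynomial (Fin n) K →ₐ[K] MvPolynomial {i : Fin n // i ≠ k} K :=
  aeval (fun i => if h : i ≠ k then X ⟨i, h⟩ else 1)

def psi : MvPolynomial (Fin n) K →ₐ[K] MvPolynomial {i : Fin n // i ≠ k} K :=
  (del k).comp (phi k p)

def theta : MvPolynomial {i : Fin n // i ≠ k} K →ₐ[K] MvPolynomial (Fin n) K :=
  aeval (fun i => X i.1 - C (cc k p i.1) * X k)

lemma psi_theta (g) : psi k p (theta k p g) = g := by
  have : (psi k p).comp (theta k p) = AlgHom.id K _ := by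
    ext1 ⟨i, hi⟩
    simp [psi, theta, phi, del, cc, hi, algHom_C]
  exact DFunLike.congr_fun this g

lemma phi'_phi (g) : phi' k p (phi k p g) = g := by
  have : (phi' k p).comp (phi k p) = AlgHom.id K _ := by
    ext1 i
    simp [phi, phi', cc, algHom_C]
  exact DFunLike.congr_fun this g

lemma const_psi (hk : p k ≠ 0) (f) :
    constantCoeff (psi k p f) = eval ((p k)⁻¹ • p) f := by
  have : (constantCoeff).comp (psi k p).toRingHom = eval ((p k)⁻¹ • p) := by
    apply MvPolynomial.ringHom_ext
    · intro a
      simp [psi, algHom_C]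
    · intro i
      by_cases hi : i = k
      · subst hi; simp [psi, phi, del, cc, hk]
      · simp [psi, phi, del, cc, hi, algHom_C, div_eq_inv_mul]
  exact DFunLike.congr_fun this f

lemma psi_cone (hk : p k ≠ 0) {f} (hf : f ∈ coneIdeal K p) :
    psi k p f ∈ idealOfVars {i : Fin n // i ≠ k} K := by
  have h := (mem_pow_idealOfVars_iff' 1 (psi k p f)).2 (by
    intro x hx
    have : x = 0 := by
      rw [← Finsupp.degree_eq_zero_iff]; omega
    subst this
    have h2 := const_psi k p hk f
    rw [hf (p k)⁻¹] at h2
    simpa [constantCoeff_eq] using h2)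
  simpa using h

lemma psi_cone_pow (hk : p k ≠ 0) {f} (m : ℕ) (hf : f ∈ coneIdeal K p ^ m) :
    psi k p f ∈ idealOfVars {i : Fin n // i ≠ k} K ^ m := by
  have h1 : coneIdeal K p ≤ (idealOfVars {i : Fin n // i ≠ k} K).comap (psi k p) :=
    fun x hx => psi_cone k p hk hx
  have h2 := Ideal.pow_right_mono h1 m hf
  exact Ideal.le_comap_pow (psi k p) m h2

lemma lin_cone (hk : p k ≠ 0) {i} (hi : i ≠ k) :
    (X i - C (cc k p i) * X k : MvPolynomial (Fin n) K) ∈ coneIdeal K p := by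
  intro t
  simp [cc, hi]
  field_simp
  simp

lemma del_monomial (b : Fin n →₀ ℕ) (c : K) :
    del k (monomial b c) = monomial (b.subtypeDomain (· ≠ k)) c := by
  rw [del, aeval_monomial, monomial_eq, algebraMap_eq, Finsupp.prod_fintype _ _ (by simp),
    Finsupp.prod_fintype _ _ (by simp)]
  congr 1
  rw [← Fintype.prod_subtype_mul_prod_subtype (fun i => i ≠ k)]
  rw [Finset.prod_congr rfl (g := fun i : {i // i ≠ k} => X i ^ b i)]
  · rw [Finset.prod_eq_one (s := (Finset.univ : Finset {i // ¬ i ≠ k}))]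
    · simp
    · rintro ⟨i, hi⟩ -
      simp [hi]
  · rintro ⟨i, hi⟩ -
    simp [hi]

lemma deg_sub (b : Fin n →₀ ℕ) :
    b.degree = (b.subtypeDomain (· ≠ k)).degree + b k := by
  rw [Finsupp.degree_eq_sum, Finsupp.degree_eq_sum, ← Fintype.sum_subtype_add_sum_subtype (fun i => i ≠ k)]
  congr 1
  rw [Fintype.sum_eq_single ⟨k, by simp⟩]
  rintro ⟨i, hi⟩ h
  exact absurd (Subtype.ext (not_not.1 hi)) h

lemma phi_hom {f : MvPolynomial (Fin n) K} {t} (hf : f.IsHomogeneous t) :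
    (phi k p f).IsHomogeneous t := by
  have := hf.aeval (fun i => X i + C (cc k p i) * X k) (n := 1) (fun i => by
    refine (isHomogeneous_X _ _).add ?_
    simpa using (isHomogeneous_C _ _).mul (isHomogeneous_X K k))
  simpa [phi] using this

lemma theta_hom {f} {t} (hf : f.IsHomogeneous t) :
    (theta k p f).IsHomogeneous t := by
  have := hf.aeval (fun i : {i // i ≠ k} => X i.1 - C (cc k p i.1) * X k) (n := 1) (fun i => by
    refine (isHomogeneous_X _ _).sub ?_
    simpa using (isHomogeneous_C _ _).mul (isHomogeneous_X K k))
  simpa [theta] using this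

lemma theta_mem (hk : p k ≠ 0) {f} {t} (hf : f.IsHomogeneous t) :
    theta k p f ∈ coneIdeal K p ^ t := by
  have h0 : f ∈ idealOfVars {i : Fin n // i ≠ k} K ^ t := by
    rw [mem_pow_idealOfVars_iff']
    intro x hx
    exact hf.coeff_eq_zero (by omega)
  have h1 : idealOfVars {i : Fin n // i ≠ k} K ≤ (coneIdeal K p).comap (theta k p) := by
    rw [idealOfVars, Ideal.span_le]
    rintro _ ⟨⟨i, hi⟩, rfl⟩
    simpa [theta] using lin_cone k p hk hi
  exact Ideal.le_comap_pow (theta k p) t (Ideal.pow_right_mono h1 t h0)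

lemma coeff_del {h : MvPolynomial (Fin n) K} {t} (hh : h.IsHomogeneous t) (b : Fin n →₀ ℕ)
    (hb : b ∈ h.support) :
    coeff (b.subtypeDomain (· ≠ k)) (del k h) = coeff b h := by
  have hdeg : ∀ x ∈ h.support, x.degree = t := by
    intro x hx
    rw [Finsupp.degree_eq_weight_one]
    exact hh (mem_support_iff.1 hx)
  conv_lhs => rw [h.as_sum, map_sum, coeff_sum]
  rw [Finset.sum_eq_single b]
  · rw [del_monomial, coeff_monomial, if_pos rfl]
  · intro x hx hxb
    rw [del_monomial, coeff_monomial, if_neg]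
    intro he
    apply hxb
    have h1 := hdeg x hx
    have h2 := hdeg b hb
    rw [deg_sub k] at h1 h2
    rw [he] at h1
    ext i
    by_cases hi : i = k
    · subst hi; omega
    · exact DFunLike.congr_fun he ⟨i, hi⟩
  · intro h; exact absurd hb h

lemma mem_of_psi (hk : p k ≠ 0) {f : MvPolynomial (Fin n) K} {t} (hf : f.IsHomogeneous t) {m : ℕ}
    (h : psi k p f ∈ idealOfVars {i : Fin n // i ≠ k} K ^ m) : f ∈ coneIdeal K p ^ m := by
  rw [← phi'_phi k p f, (phi k p f).as_sum, map_sum]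
  refine Ideal.sum_mem _ fun b hb => ?_
  have hc := coeff_del k (phi_hom k p hf) b hb
  have hd : m ≤ (b.subtypeDomain (· ≠ k)).degree := by
    rw [mem_pow_idealOfVars_iff] at h
    apply h
    rw [mem_support_iff]
    change coeff _ (del k (phi k p f)) ≠ 0
    rw [hc]; exact mem_support_iff.1 hb
  rw [phi', aeval_monomial, Finsupp.prod_fintype _ _ (by simp)]
  apply Ideal.mul_mem_left
  apply Ideal.pow_le_pow_right hd
  rw [← Fintype.prod_subtype_mul_prod_subtype (fun i => i ≠ k), Finsupp.degree_eq_sum,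
    ← Finset.prod_pow_eq_pow_sum]
  apply Ideal.mul_mem_right
  apply Ideal.prod_mem_prod
  rintro ⟨i, hi⟩ -
  exact Ideal.pow_mem_pow (lin_cone k p hk hi) _

end pt

lemma rank_aux {K V U : Type*} [Field K] [AddCommGroup V] [Module K V] [AddCommGroup U] [Module K U]
    (L : V →ₗ[K] U) (W : Submodule K V) [FiniteDimensional K W] :
    Module.finrank K W = Module.finrank K ↥(W ⊓ LinearMap.ker L) + Module.finrank K (W.map L) := by
  have h := (L.domRestrict W).finrank_range_add_finrank_ker
  rw [LinearMap.range_domRestrict, LinearMap.ker_domRestrict] at h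
  rw [← h, ← Submodule.map_comap_subtype, Submodule.finrank_map_subtype_eq]
  simp [add_comm]

instance homComp_fd (K : Type*) [Field K] {n : ℕ} (I : Ideal (MvPolynomial (Fin n) K)) (t : ℕ) :
    FiniteDimensional K (homComp K I t) := by
  have : FiniteDimensional K (homogeneousSubmodule (Fin n) K t) :=
    Module.Finite.iff_fg.2 (homogeneousSubmodule_fg _ _ t)
  exact Submodule.finiteDimensional_of_le (inf_le_right)

def lam {K : Type*} [Field K] {n : ℕ} (k : Fin n) (p : Fin n → K) (m : ℕ) :
    MvPolynomial (Fin n) K →ₗ[K] MvPolynomial {i : Fin n // i ≠ k} K :=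
  (homogeneousComponent m).comp (psi k p).toLinearMap

lemma lam_ker {K : Type*} [Field K] {n s : ℕ} (p : Fin s → (Fin n → K)) (m : Fin s → ℕ)
    (j : Fin s) (k : Fin n) (hk : p j k ≠ 0) (t : ℕ) :
    homComp K (fatIdeal K p m) t ⊓ LinearMap.ker (lam k (p j) (m j)) =
      homComp K (fatIdeal K p (Function.update m j (m j + 1))) t := by
  ext f
  simp only [homComp, fatIdeal, Submodule.mem_inf, Submodule.restrictScalars_mem,
    Submodule.mem_iInf, LinearMap.mem_ker, mem_homogeneousSubmodule, lam, LinearMap.comp_apply,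
    AlgHom.toLinearMap_apply]
  constructor
  · rintro ⟨⟨h1, h2⟩, h3⟩
    refine ⟨fun i => ?_, h2⟩
    by_cases hi : i = j
    · subst hi
      rw [Function.update_self]
      refine mem_of_psi k _ hk h2 ?_
      have h4 := psi_cone_pow k _ hk _ (h1 i)
      rw [mem_pow_idealOfVars_iff'] at h4 ⊢
      intro x hx
      rcases Nat.lt_succ_iff_lt_or_eq.1 hx with h | h
      · exact h4 x h
      · have := congrArg (coeff x) h3
        rwa [coeff_homogeneousComponent, if_pos h, coeff_zero] at this
    · rw [Function.update_of_ne hi]; exact h1 i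
  · rintro ⟨h1, h2⟩
    refine ⟨⟨fun i => ?_, h2⟩, ?_⟩
    · by_cases hi : i = j
      · subst hi
        have := h1 i
        rw [Function.update_self] at this
        exact Ideal.pow_le_pow_right (Nat.le_succ _) this
      · have := h1 i
        rwa [Function.update_of_ne hi] at this
    · have := h1 j
      rw [Function.update_self] at this
      have h4 := psi_cone_pow k _ hk _ this
      rw [mem_pow_idealOfVars_iff'] at h4
      ext x
      rw [coeff_homogeneousComponent, coeff_zero]
      split_ifs with h
      · exact h4 x (by omega)
      · rfl

lemma lam_map_le {K : Type*} [Field K] {n : ℕ} (k : Fin n) (p : Fin n → K) (m : ℕ) (W) :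
    Submodule.map (lam k p m) W ≤ homogeneousSubmodule _ K m := by
  rintro _ ⟨f, -, rfl⟩
  exact homogeneousComponent_isHomogeneous m _

/-- a linear form vanishing at `q` but not at `p` -/
lemma sep {K : Type*} [Field K] {n : ℕ} (p q : Fin n → K) (hq : q ≠ 0)
    (h : ∀ c : K, p ≠ c • q) :
    ∃ L : MvPolynomial (Fin n) K, L.IsHomogeneous 1 ∧ L ∈ coneIdeal K q ∧ eval p L ≠ 0 := by
  obtain ⟨a, ha⟩ := Function.ne_iff.1 hq
  have ha : q a ≠ 0 := ha
  obtain ⟨b, hb⟩ := Function.ne_iff.1 (h (p a / q a))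
  refine ⟨C (q a) * X b - C (q b) * X a, ?_, ?_, ?_⟩
  · refine IsHomogeneous.sub ?_ ?_
    · simpa using (isHomogeneous_C _ _).mul (isHomogeneous_X K b)
    · simpa using (isHomogeneous_C _ _).mul (isHomogeneous_X K a)
  · intro t
    simp
    ring
  · simp only [map_sub, map_mul, eval_C, eval_X]
    intro h0
    apply hb
    simp only [Pi.smul_apply, smul_eq_mul]
    field_simp
    linear_combination h0

lemma lam_map_eq {K : Type*} [Field K] {n s : ℕ} (p : Fin s → (Fin n → K)) (hp : ProjDistinct K p)
    (m : Fin s → ℕ) (j : Fin s) (k : Fin n) (hk : p j k ≠ 0) (t : ℕ) (ht : ∑ i, m i ≤ t) :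
    Submodule.map (lam k (p j) (m j)) (homComp K (fatIdeal K p m) t) =
      homogeneousSubmodule _ K (m j) := by
  classical
  apply le_antisymm (lam_map_le _ _ _ _)
  intro g hg
  rw [mem_homogeneousSubmodule] at hg
  have hL : ∀ i : Fin s, ∃ L : MvPolynomial (Fin n) K, L.IsHomogeneous 1 ∧
      (i ≠ j → L ∈ coneIdeal K (p i)) ∧ eval ((p j k)⁻¹ • p j) L ≠ 0 := by
    intro i
    by_cases hi : i = j
    · exact ⟨X k, isHomogeneous_X _ _, fun h => absurd hi h, by simp [hk]⟩
    · obtain ⟨L, h1, h2, h3⟩ := sep ((p j k)⁻¹ • p j) (p i) (hp.1 i) (fun c hc => by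
        rw [inv_smul_eq_iff₀ hk, smul_smul] at hc
        exact hp.2 j i (Ne.symm hi) _ hc)
      exact ⟨L, h1, fun _ => h2, h3⟩
  choose L hL1 hL2 hL3 using hL
  set F : MvPolynomial (Fin n) K :=
    (∏ i ∈ Finset.univ.erase j, L i ^ m i) * X k ^ (t - ∑ i, m i) with hF
  have hsum : ∑ i ∈ Finset.univ.erase j, m i + m j = ∑ i, m i :=
    Finset.sum_erase_add _ _ (Finset.mem_univ j)
  have hFhom : F.IsHomogeneous (t - m j) := by
    have h1 : (∏ i ∈ Finset.univ.erase j, L i ^ m i).IsHomogeneous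
        (∑ i ∈ Finset.univ.erase j, m i) :=
      IsHomogeneous.prod _ _ _ (fun i _ => by simpa using (hL1 i).pow (m i))
    have h2 := h1.mul ((isHomogeneous_X K k).pow (t - ∑ i, m i))
    convert h2 using 1
    omega
  set c := constantCoeff (psi k (p j) F) with hc
  have hc0 : c ≠ 0 := by
    rw [hc, const_psi k _ hk, hF, map_mul, map_prod]
    refine mul_ne_zero (Finset.prod_ne_zero_iff.2 fun i _ => ?_) ?_
    · rw [map_pow]; exact pow_ne_zero _ (hL3 i)
    · rw [map_pow]; exact pow_ne_zero _ (by simp [hk])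
  have hG := theta_hom k (p j) hg
  have hGm := theta_mem k (p j) hk hg
  refine ⟨c⁻¹ • (F * theta k (p j) g), Submodule.smul_mem _ _ ⟨?_, ?_⟩, ?_⟩
  · simp only [fatIdeal, SetLike.mem_coe, Submodule.restrictScalars_mem, Submodule.mem_iInf]
    intro i
    by_cases hi : i = j
    · subst hi; exact Ideal.mul_mem_left _ _ hGm
    · apply Ideal.mul_mem_right
      apply Ideal.mul_mem_right
      rw [← Finset.mul_prod_erase _ _ (Finset.mem_erase.2 ⟨hi, Finset.mem_univ i⟩)]
      exact Ideal.mul_mem_right _ _ (Ideal.pow_mem_pow (hL2 i hi) _)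
  · have := hFhom.mul hG
    rwa [Nat.sub_add_cancel (by omega)] at this
  · rw [map_smul, inv_smul_eq_iff₀ hc0]
    simp only [lam, LinearMap.comp_apply, AlgHom.toLinearMap_apply, map_mul, psi_theta]
    have h1 : psi k (p j) F - C c ∈ idealOfVars {i : Fin n // i ≠ k} K ^ 1 := by
      rw [mem_pow_idealOfVars_iff']
      intro x hx
      have : x = 0 := by
        rw [← Finsupp.degree_eq_zero_iff]; omega
      subst this
      simp [hc, constantCoeff_eq]
    have h2 : g ∈ idealOfVars {i : Fin n // i ≠ k} K ^ m j := by
      rw [mem_pow_idealOfVars_iff']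
      intro x hx
      exact hg.coeff_eq_zero (by omega)
    have h3 := Ideal.mul_mem_mul h1 h2
    rw [← pow_add, mem_pow_idealOfVars_iff'] at h3
    have h4 : psi k (p j) F * g = c • g + (psi k (p j) F - C c) * g := by
      rw [smul_eq_C_mul]; ring
    rw [h4, map_add, map_smul, homogeneousComponent_of_mem hg, if_pos rfl]
    convert add_zero _
    ext x
    rw [coeff_homogeneousComponent, coeff_zero]
    split_ifs with h
    · exact h3 x (by omega)
    · rfl

lemma step {K : Type*} [Field K] {N s : ℕ} (hN : 1 ≤ N) (p : Fin s → (Fin (N + 1) → K))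
    (hp : ProjDistinct K p)
    (m : Fin s → ℕ) (j : Fin s) (t : ℕ) :
    Module.finrank K (homComp K (fatIdeal K p m) t) ≤
      Module.finrank K (homComp K (fatIdeal K p (Function.update m j (m j + 1))) t)
        + (m j + N - 1).choose (N - 1) ∧
    (∑ i, m i ≤ t → Module.finrank K (homComp K (fatIdeal K p m) t) =
      Module.finrank K (homComp K (fatIdeal K p (Function.update m j (m j + 1))) t)
        + (m j + N - 1).choose (N - 1)) := by
  obtain ⟨k, hk⟩ := Function.ne_iff.1 (hp.1 j)
  have hk : p j k ≠ 0 := hk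
  have hd : Module.finrank K (homogeneousSubmodule {i : Fin (N + 1) // i ≠ k} K (m j)) =
      (m j + N - 1).choose (N - 1) := by
    rw [finrank_hom_aux]
    have : Fintype.card {i : Fin (N + 1) // i ≠ k} = N := by simp
    rw [this, add_comm N]
    exact Nat.choose_symm_of_eq_add (by omega)
  have : FiniteDimensional K (homogeneousSubmodule {i : Fin (N + 1) // i ≠ k} K (m j)) :=
    Module.Finite.iff_fg.2 (homogeneousSubmodule_fg _ _ _)
  have h := rank_aux (lam k (p j) (m j)) (homComp K (fatIdeal K p m) t)
  rw [lam_ker p m j k hk t] at h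
  constructor
  · rw [h, ← hd]
    gcongr
    exact Submodule.finrank_mono (lam_map_le _ _ _ _)
  · intro ht
    rw [h, lam_map_eq p hp m j k hk t ht, hd]

lemma main_aux {K : Type*} [Field K] {N s : ℕ} (hN : 1 ≤ N) (p : Fin s → (Fin (N + 1) → K))
    (hp : ProjDistinct K p) (t : ℕ) (n : ℕ) : ∀ m : Fin s → ℕ, ∑ i, m i = n →
    ((t + N).choose N ≤ Module.finrank K (homComp K (fatIdeal K p m) t) +
      ∑ i, (m i + N - 1).choose N) ∧
    (n ≤ t + 1 → (t + N).choose N = Module.finrank K (homComp K (fatIdeal K p m) t) +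
      ∑ i, (m i + N - 1).choose N) := by
  induction n with
  | zero =>
    intro m hm
    have hm0 : ∀ i, m i = 0 := by simpa using hm
    have h1 : homComp K (fatIdeal K p m) t = homogeneousSubmodule _ K t := by
      simp [homComp, fatIdeal, hm0]
    have h2 : ∑ i, (m i + N - 1).choose N = 0 :=
      Finset.sum_eq_zero fun i _ => by
        rw [hm0]; exact Nat.choose_eq_zero_of_lt (by omega)
    have h3 : Module.finrank K (homComp K (fatIdeal K p m) t) = (t + N).choose N := by
      rw [h1, finrank_hom_aux, Fintype.card_fin]
      rw [show N + 1 + t - 1 = t + N by omega]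
      exact Nat.choose_symm_add
    rw [h2, h3]; simp
  | succ n ih =>
    intro m hm
    obtain ⟨j, hj⟩ : ∃ j, m j ≠ 0 := by
      by_contra! h
      simp [h] at hm
    obtain ⟨a, ha⟩ := Nat.exists_eq_succ_of_ne_zero hj
    set m' := Function.update m j a with hm'
    have hmm : m = Function.update m' j (m' j + 1) := by
      simp [hm', ← Nat.succ_eq_add_one, ← ha]
    have hs1 : ∀ f : ℕ → ℕ, ∑ i, f (m i) + f a = ∑ i, f (m' i) + f (a + 1) := by
      intro f
      rw [← Finset.sum_erase_add _ _ (Finset.mem_univ j),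
        ← Finset.sum_erase_add (a := j) _ (fun i => f (m' i)) (Finset.mem_univ j)]
      have : ∑ i ∈ Finset.univ.erase j, f (m' i) = ∑ i ∈ Finset.univ.erase j, f (m i) :=
        Finset.sum_congr rfl fun i hi => by
          rw [hm', Function.update_of_ne (Finset.ne_of_mem_erase hi)]
      rw [this, ha]
      simp [hm']
      omega
    have hsum : ∑ i, m' i = n := by
      have := hs1 id
      simp only [id] at this
      omega
    have hch := hs1 (fun x => (x + N - 1).choose N)
    have hpas : (a + 1 + N - 1).choose N = (a + N - 1).choose (N - 1) + (a + N - 1).choose N := by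
      obtain ⟨M, rfl⟩ := Nat.exists_eq_add_of_le' hN
      rw [show a + 1 + (M + 1) - 1 = (a + M) + 1 by omega, show a + (M + 1) - 1 = a + M by omega]
      exact Nat.choose_succ_succ _ _
    have hst := step hN p hp m' j t
    rw [← hmm] at hst
    have hma : m' j = a := by simp [hm']
    rw [hma] at hst
    obtain ⟨i1, i2⟩ := ih m' hsum
    constructor
    · have := hst.1
      omega
    · intro hn
      have := hst.2 (by omega)
      have := i2 (by omega)
      omega

set_option maxHeartbeats 1000000 in
/-- For a fat point subscheme `Z = m_1 p_1 + ⋯ + m_s p_s ⊆ ℙ^N`, the dimension of the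
degree-`t` part of `I(Z)` is at least `max {0, C(t+N,N) − Σ_i C(m_i+N−1,N)}`, with
equality for all `t ≥ (Σ_i m_i) − 1`. -/
theorem fat_points_conditions (K : Type*) [Field K] [IsAlgClosed K]
    (N s : ℕ) (hN : 1 ≤ N)
    (p : Fin s → (Fin (N + 1) → K)) (hp : ProjDistinct K p)
    (m : Fin s → ℕ) (hm : ∃ i, 0 < m i) :
    (∀ t : ℕ,
      max 0 (((t + N).choose N : ℤ) - ∑ i, ((m i + N - 1).choose N : ℤ))
        ≤ (Module.finrank K ↥(homComp K (fatIdeal K p m) t) : ℤ)) ∧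
    (∀ t : ℕ, (∑ i, m i) - 1 ≤ t →
      (Module.finrank K ↥(homComp K (fatIdeal K p m) t) : ℤ)
        = max 0 (((t + N).choose N : ℤ) - ∑ i, ((m i + N - 1).choose N : ℤ))) := by
  have key := fun t => main_aux hN p hp t _ m rfl
  refine ⟨fun t => ?_, fun t ht => ?_⟩
  · have := (key t).1
    zify at this
    apply max_le <;> linarith
  · have := (key t).2 (by omega)
    zify at this
    rw [max_eq_right] <;> linarith

end
end

section
/- Let Z be a nonzero fat point subscheme of ℙ^N. For every positive integer m, α(I(mZ))/(N+m−1) ≤ α̂(I(Z)) ≤ α(I(mZ))/m. In particular (taking m = 1), α(I(Z))/N ≤ α̂(I(Z)) (the Waldschmidt–Skoda bound). -/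
open MvPolynomial

noncomputable section

namespace WS

def wt {n : ℕ} (j : Fin n) (a : Fin n →₀ ℕ) : ℕ := ∑ l ∈ Finset.univ.erase j, a l

lemma wt_add {n : ℕ} (j : Fin n) (a b : Fin n →₀ ℕ) : wt j (a + b) = wt j a + wt j b := by
  simp [wt, Finset.sum_add_distrib]

lemma wt_zero {n : ℕ} (j : Fin n) : wt j 0 = 0 := by simp [wt]

/-- polynomials of order at least `M` in the variables other than `j` -/
def WI (R : Type*) [CommRing R] {n : ℕ} (j : Fin n) (M : ℕ) : Ideal (MvPolynomial (Fin n) R) where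
  carrier := {g | ∀ a, wt j a < M → coeff a g = 0}
  add_mem' := by
    intro f g hf hg a ha
    simp [hf a ha, hg a ha]
  zero_mem' := by
    intro a ha
    simp
  smul_mem' := by
    intro c f hf a ha
    rw [smul_eq_mul, coeff_mul]
    refine Finset.sum_eq_zero fun x hx => ?_
    rw [Finset.HasAntidiagonal.mem_antidiagonal] at hx
    rw [hf x.2, mul_zero]
    rw [← hx, wt_add] at ha
    omega

lemma mem_WI {R : Type*} [CommRing R] {n : ℕ} {j : Fin n} {M : ℕ} {g : MvPolynomial (Fin n) R} :
    g ∈ WI R j M ↔ ∀ a, wt j a < M → coeff a g = 0 := Iff.rfl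

lemma WI_mul {R : Type*} [CommRing R] {n : ℕ} {j : Fin n} {M M' : ℕ}
    {f g : MvPolynomial (Fin n) R} (hf : f ∈ WI R j M) (hg : g ∈ WI R j M') :
    f * g ∈ WI R j (M + M') := by
  intro a ha
  rw [coeff_mul]
  refine Finset.sum_eq_zero fun x hx => ?_
  rw [Finset.HasAntidiagonal.mem_antidiagonal] at hx
  rw [← hx, wt_add] at ha
  by_cases h : wt j x.1 < M
  · rw [hf _ h, zero_mul]
  · rw [hg x.2 (by omega), mul_zero]

lemma WI_zero {R : Type*} [CommRing R] {n : ℕ} {j : Fin n} (g : MvPolynomial (Fin n) R) :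
    g ∈ WI R j 0 := fun a ha => by omega

lemma WI_mono {R : Type*} [CommRing R] {n : ℕ} {j : Fin n} {M M' : ℕ} (h : M ≤ M')
    {g : MvPolynomial (Fin n) R} (hg : g ∈ WI R j M') : g ∈ WI R j M :=
  fun a ha => hg a (by omega)

lemma WI_pow {R : Type*} [CommRing R] {n : ℕ} {j : Fin n} {M : ℕ} (T : ℕ)
    {f : MvPolynomial (Fin n) R} (hf : f ∈ WI R j M) : f ^ T ∈ WI R j (T * M) := by
  induction T with
  | zero => simpa using WI_zero _
  | succ T ih =>
    rw [pow_succ, Nat.succ_mul]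
    exact WI_mul ih hf

lemma WI_ideal_pow {R : Type*} [CommRing R] {n : ℕ} (j : Fin n) (M : ℕ) :
    (WI R j 1) ^ M = WI R j M := by
  apply le_antisymm
  · induction M with
    | zero => intro g _; exact WI_zero g
    | succ M ih =>
      rw [pow_succ, Ideal.mul_le]
      intro r hr s hs
      exact WI_mul (ih hr) hs
  · intro g hg
    rw [g.as_sum]
    refine Ideal.sum_mem _ fun a ha => ?_
    have hwt : M ≤ wt j a := by
      by_contra h
      exact (mem_support_iff.1 ha) (hg a (by omega))
    rw [monomial_eq, Finsupp.prod_fintype _ _ (by simp)]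
    refine Ideal.mul_mem_left _ _ ?_
    rw [← Finset.mul_prod_erase Finset.univ _ (Finset.mem_univ j)]
    refine Ideal.mul_mem_left _ _ (Ideal.pow_le_pow_right hwt ?_)
    rw [wt, ← Finset.prod_pow_eq_pow_sum]
    refine Ideal.prod_mem_prod fun l hl => Ideal.pow_mem_pow ?_ _
    intro b hb
    rw [coeff_X, if_neg]
    rintro rfl
    have : wt j (Finsupp.single l 1) = 1 := by
      rw [wt, Finset.sum_eq_single l] <;> simp_all [Finsupp.single_apply]
    omega

def sig {R : Type*} [CommRing R] {n : ℕ} (c : Fin n → R) (j : Fin n) :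
    MvPolynomial (Fin n) R →ₐ[R] MvPolynomial (Fin n) R :=
  aeval (fun l => if l = j then X j else X l + C (c l) * X j)

lemma sig_neg {R : Type*} [CommRing R] {n : ℕ} (c : Fin n → R) (j : Fin n)
    (F : MvPolynomial (Fin n) R) : sig (-c) j (sig c j F) = F := by
  have : (sig (-c) j).comp (sig c j) = AlgHom.id R _ := by
    ext l : 1
    by_cases h : l = j <;> simp [sig, h, algHom_C]
  exact DFunLike.congr_fun this F

lemma sig_neg' {R : Type*} [CommRing R] {n : ℕ} (c : Fin n → R) (j : Fin n)
    (F : MvPolynomial (Fin n) R) : sig c j (sig (-c) j F) = F := by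
  have := sig_neg (-c) j F
  rwa [neg_neg] at this

lemma sig_map {R S : Type*} [CommRing R] [CommRing S] (f : R →+* S) {n : ℕ} (c : Fin n → R)
    (j : Fin n) (F : MvPolynomial (Fin n) R) :
    sig (fun l => f (c l)) j (map f F) = map f (sig c j F) := by
  induction F using MvPolynomial.induction_on with
  | C a => simp [algHom_C]
  | add p q hp hq => simp [hp, hq]
  | mul_X p l hp =>
    simp only [map_mul, hp, map_X]
    by_cases h : l = j <;> simp [sig, h]

lemma sig_hom {R : Type*} [CommRing R] {n : ℕ} (c : Fin n → R) (j : Fin n)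
    {F : MvPolynomial (Fin n) R} {d : ℕ} (hF : F.IsHomogeneous d) : (sig c j F).IsHomogeneous d := by
  have := hF.aeval (fun l => if l = j then X j else X l + C (c l) * X j) (n := 1) (by
    intro i
    split_ifs
    · exact isHomogeneous_X _ _
    · refine (isHomogeneous_X _ _).add ?_
      simpa using (isHomogeneous_C (Fin n) (c i)).mul (isHomogeneous_X R j))
  rw [one_mul] at this
  exact this

lemma sig_comp {R : Type*} [CommRing R] {n : ℕ} (c : Fin n → R) (j : Fin n)
    {F : MvPolynomial (Fin n) R} {M : ℕ} (hF : sig c j F ∈ WI R j M) (e : ℕ) :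
    sig c j (homogeneousComponent e F) ∈ WI R j M := by
  intro a ha
  by_cases h : a.degree = e
  · have h1 := hF a ha
    rw [← sum_homogeneousComponent F, map_sum, coeff_sum] at h1
    by_cases h3 : e ≤ F.totalDegree
    · rw [Finset.sum_eq_single e] at h1
      · exact h1
      · intro b _ hb
        exact (sig_hom c j (homogeneousComponent_isHomogeneous b F)).coeff_eq_zero (by omega)
      · intro h2
        simp at h2
        omega
    · rw [homogeneousComponent_eq_zero _ _ (by omega)]; simp
  · exact (sig_hom c j (homogeneousComponent_isHomogeneous e F)).coeff_eq_zero h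

lemma cone_single {K : Type*} [Field K] [Infinite K] {n : ℕ} (j : Fin n) :
    coneIdeal K (Pi.single j (1 : K)) = WI K j 1 := by
  ext g
  constructor
  · intro hg a ha
    -- restrict to the line
    let P : Polynomial K := aeval (fun l => if l = j then Polynomial.X else 0) g
    have hP : ∀ Q : MvPolynomial (Fin n) K, ∀ t : K,
        (aeval (fun l => if l = j then (Polynomial.X : Polynomial K) else 0) Q).eval t
          = eval (t • Pi.single j (1 : K)) Q := by
      intro Q t
      induction Q using MvPolynomial.induction_on with
      | C a => simp
      | add p q hp hq => simp [hp, hq]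
      | mul_X p l hp =>
        simp only [map_mul, Polynomial.eval_mul, hp, aeval_X, eval_X]
        by_cases h : l = j <;> simp [h, Pi.single_apply]
    have hco : ∀ Q : MvPolynomial (Fin n) K, ∀ k : ℕ,
        (aeval (fun l => if l = j then (Polynomial.X : Polynomial K) else 0) Q).coeff k
          = coeff (Finsupp.single j k) Q := by
      intro Q k
      induction Q using MvPolynomial.monomial_add_induction_on with
      | C a => simp [MvPolynomial.coeff_C, Polynomial.coeff_C, eq_comm]
      | monomial_add u b f _ _ hf =>
        simp only [map_add, Polynomial.coeff_add, hf, coeff_add]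
        congr 1
        rw [aeval_monomial, Finsupp.prod_fintype _ _ (by simp), coeff_monomial]
        by_cases hu : ∃ l, l ≠ j ∧ u l ≠ 0
        · obtain ⟨l, hl, hl'⟩ := hu
          rw [Finset.prod_eq_zero (Finset.mem_univ l) (by simp [hl, hl']), if_neg]
          · simp
          · rintro rfl
            simp [Finsupp.single_apply, hl.symm] at hl'
        · push Not at hu
          rw [Finset.prod_eq_single j (by intro l _ hl; simp [hu l hl]) (by simp)]
          have : u = Finsupp.single j (u j) := by
            ext l
            by_cases h : l = j
            · simp [h]
            · simp [hu l h, Finsupp.single_apply, Ne.symm h]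
          rw [this]
          simp [Polynomial.coeff_X_pow, (Finsupp.single_injective j).eq_iff, eq_comm]
    have h0 : P = 0 := by
      apply Polynomial.funext
      intro t
      rw [hP, hg t]; simp
    have ha' : a = Finsupp.single j (a j) := by
      ext l
      by_cases h : l = j
      · simp [h]
      · have : wt j a = 0 := by omega
        rw [wt, Finset.sum_eq_zero_iff] at this
        simp [this l (by simp [h]), Finsupp.single_apply, Ne.symm h]
    rw [ha', ← hco]
    change P.coeff _ = 0
    rw [h0]; simp
  · intro hg t
    rw [g.as_sum, map_sum]
    refine Finset.sum_eq_zero fun a ha => ?_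
    have : wt j a ≠ 0 := fun h => (mem_support_iff.1 ha) (hg a (by omega))
    obtain ⟨l, hl, hl'⟩ := Finset.exists_ne_zero_of_sum_ne_zero this
    rw [eval_monomial, Finsupp.prod_fintype _ _ (by simp),
      Finset.prod_eq_zero (Finset.mem_univ l), mul_zero]
    have : l ≠ j := by simpa using hl
    simp [this, hl']


lemma eval_sig {K : Type*} [Field K] {n : ℕ} (p : Fin n → K) (j : Fin n) (hj : p j ≠ 0) (t : K)
    (f : MvPolynomial (Fin n) K) :
    eval (t • Pi.single j (1 : K)) (sig (fun l => p l / p j) j f) = eval ((t / p j) • p) f := by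
  induction f using MvPolynomial.induction_on with
  | C a => simp [algHom_C]
  | add p q hp hq => simp [hp, hq]
  | mul_X q l hq =>
    simp only [map_mul, hq]
    congr 1
    by_cases h : l = j
    · subst h; simp [sig, hj]
    · simp [sig, h]; field_simp

def sigE {R : Type*} [CommRing R] {n : ℕ} (c : Fin n → R) (j : Fin n) :
    MvPolynomial (Fin n) R ≃+* MvPolynomial (Fin n) R where
  toFun := sig c j
  invFun := sig (-c) j
  left_inv := sig_neg c j
  right_inv := sig_neg' c j
  map_mul' := map_mul _
  map_add' := map_add _

lemma cone_eq {K : Type*} [Field K] [Infinite K] {n : ℕ} (p : Fin n → K) (j : Fin n)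
    (hj : p j ≠ 0) :
    coneIdeal K p = (WI K j 1).comap (sigE (fun l => p l / p j) j) := by
  ext f
  rw [Ideal.mem_comap, ← cone_single]
  constructor
  · intro h t
    exact (eval_sig p j hj t f).trans (h _)
  · intro h t
    have h1 := h (t * p j)
    have h2 := eval_sig p j hj (t * p j) f
    rw [mul_div_assoc, div_self hj, mul_one] at h2
    exact h2.symm.trans h1

lemma cone_pow {K : Type*} [Field K] [Infinite K] {n : ℕ} (p : Fin n → K) (j : Fin n)
    (hj : p j ≠ 0) (M : ℕ) (F : MvPolynomial (Fin n) K) :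
    F ∈ coneIdeal K p ^ M ↔ sig (fun l => p l / p j) j F ∈ WI K j M := by
  rw [cone_eq p j hj, ← Ideal.map_symm, ← Ideal.map_pow, WI_ideal_pow, Ideal.map_symm,
    Ideal.mem_comap]
  rfl

lemma exists_phi {k : Type*} [Field k] (p : ℕ) [Fact p.Prime] [CharP k p] [PerfectRing k p]
    {n : ℕ} (e : ℕ) (b : Fin n →₀ ℕ) (hb : ∀ l, b l < p ^ e) :
    ∃ φ : MvPolynomial (Fin n) k →+ MvPolynomial (Fin n) k,
      (∀ H a, (coeff a (φ H)) ^ (p ^ e) = coeff (p ^ e • a + b) H) ∧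
      ∀ g h, φ (g ^ (p ^ e) * h) = g * φ h := by
  have hq : 0 < p ^ e := pow_pos (Fact.out : p.Prime).pos _
  have hinj : Function.Injective (fun a : Fin n →₀ ℕ => p ^ e • a + b) := by
    intro a a' h
    ext l
    have := DFunLike.congr_fun h l
    simp only [Finsupp.add_apply, Finsupp.smul_apply, smul_eq_mul, add_left_inj] at this
    exact Nat.eq_of_mul_eq_mul_left hq this
  let ψ : MvPolynomial (Fin n) k →+ MvPolynomial (Fin n) k :=
    { toFun := fun H => AddMonoidAlgebra.comapDomain (fun a : Fin n →₀ ℕ => p ^ e • a + b) hinj H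
      map_zero' := AddMonoidAlgebra.comapDomain_zero _ hinj
      map_add' := AddMonoidAlgebra.comapDomain_add _ hinj }
  have hψ : ∀ H a, coeff a (ψ H) = coeff (p ^ e • a + b) H := by
    intro H a
    rfl
  let φ : MvPolynomial (Fin n) k →+ MvPolynomial (Fin n) k :=
    (map ((iterateFrobeniusEquiv k p e).symm : k →+* k)).toAddMonoidHom.comp ψ
  have hφ : ∀ H a, (coeff a (φ H)) ^ (p ^ e) = coeff (p ^ e • a + b) H := by
    intro H a
    rw [← hψ, ← iterateFrobeniusEquiv_def]
    change iterateFrobeniusEquiv k p e (coeff a (map ((iterateFrobeniusEquiv k p e).symm : k →+* k) (ψ H))) = _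
    rw [coeff_map]
    exact RingEquiv.apply_symm_apply _ _
  refine ⟨φ, hφ, ?_⟩
  intro g h
  induction g using MvPolynomial.induction_on' with
  | monomial u y =>
    ext a
    apply (iterateFrobeniusEquiv k p e).injective
    rw [iterateFrobeniusEquiv_def, iterateFrobeniusEquiv_def, hφ, monomial_pow,
      coeff_monomial_mul', coeff_monomial_mul']
    have hle : p ^ e • u ≤ p ^ e • a + b ↔ u ≤ a := by
      constructor
      · intro h l
        have h1 := h l
        have h2 := hb l
        simp only [Finsupp.add_apply, Finsupp.smul_apply, smul_eq_mul] at h1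
        by_contra hc
        have : p ^ e * (a l + 1) ≤ p ^ e * u l := Nat.mul_le_mul_left _ (by omega)
        rw [mul_add] at this
        omega
      · intro h l
        have := Nat.mul_le_mul_left (p ^ e) (h l)
        simp only [Finsupp.add_apply, Finsupp.smul_apply, smul_eq_mul]
        omega
    by_cases hu : u ≤ a
    · rw [if_pos (hle.2 hu), if_pos hu, mul_pow, hφ]
      congr 2
      ext l
      have := hu l
      simp only [Finsupp.add_apply, Finsupp.smul_apply, smul_eq_mul, Finsupp.tsub_apply,
        Nat.mul_sub]
      have := Nat.mul_le_mul_left (p ^ e) (hu l)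
      omega
    · rw [if_neg (fun h => hu (hle.1 h)), if_neg hu, zero_pow hq.ne']
  | add g g' hg hg' =>
    rw [add_pow_char_pow, add_mul, map_add, hg, hg', add_mul]

lemma phi_van {k : Type*} [Field k] (p : ℕ) [Fact p.Prime] [CharP k p] [PerfectRing k p]
    {N : ℕ} (q : ℕ) (e : ℕ) (hqe : q = p ^ e)
    (φ : MvPolynomial (Fin (N + 1)) k →+ MvPolynomial (Fin (N + 1)) k)
    (hφ : ∀ g h, φ (g ^ q * h) = g * φ h) (c : Fin (N + 1) → k) (j : Fin (N + 1)) (M K' : ℕ)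
    (hM : q * K' + N * (q - 1) < M + q) (H : MvPolynomial (Fin (N + 1)) k)
    (hH : sig c j H ∈ WI k j M) : sig c j (φ H) ∈ WI k j K' := by
  have hq : 0 < q := hqe ▸ pow_pos (Fact.out : p.Prime).pos _
  rw [← sig_neg c j H, (sig c j H).as_sum, map_sum, map_sum, map_sum]
  refine Ideal.sum_mem _ fun a ha => ?_
  have hwt : M ≤ wt j a := by
    by_contra h
    exact (mem_support_iff.1 ha) (hH a (by omega))
  let u : Fin (N + 1) →₀ ℕ := Finsupp.equivFunOnFinite.symm fun l => a l / q
  let v : Fin (N + 1) →₀ ℕ := Finsupp.equivFunOnFinite.symm fun l => a l % q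
  have huv : a = q • u + v := by
    ext l
    simp [u, v, Nat.div_add_mod]
  obtain ⟨y, hy⟩ := (iterateFrobeniusEquiv k p e).surjective (coeff a (sig c j H))
  rw [iterateFrobeniusEquiv_def, ← hqe] at hy
  have hmon : monomial a (coeff a (sig c j H)) = (monomial u y) ^ q * monomial v 1 := by
    rw [monomial_pow, monomial_mul, ← huv, hy, mul_one]
  rw [hmon, map_mul, map_pow, hφ, map_mul, sig_neg']
  refine Ideal.mul_mem_right _ _ ?_
  intro d hd
  rw [coeff_monomial, if_neg]
  rintro rfl
  have h1 : wt j a = q * wt j u + wt j v := by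
    rw [huv, wt_add]
    simp [wt, Finset.mul_sum]
  have h2 : wt j v ≤ N * (q - 1) := by
    have := Finset.sum_le_card_nsmul (Finset.univ.erase j) v (q - 1) (by
      intro l _
      have := Nat.mod_lt (a l) hq
      simp only [v, Finsupp.equivFunOnFinite_symm_apply_apply]
      omega)
    simpa [wt] using this
  have h3 : q * (wt j u + 1) ≤ q * K' := Nat.mul_le_mul_left _ hd
  rw [mul_add] at h3
  omega

lemma main_charp {k : Type*} [Field k] (p : ℕ) [Fact p.Prime] [CharP k p] [PerfectRing k p]
    {N s : ℕ} (hN : 1 ≤ N) (c : Fin s → Fin (N + 1) → k) (j : Fin s → Fin (N + 1))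
    (m : Fin s → ℕ) (r kk e T : ℕ) (hT : p ^ e * (N + kk - 1) ≤ r * T)
    (F : MvPolynomial (Fin (N + 1)) k) (hF0 : F ≠ 0)
    (hF : ∀ i, sig (c i) (j i) F ∈ WI k (j i) (r * m i)) :
    ∃ G : MvPolynomial (Fin (N + 1)) k, G ≠ 0 ∧ (∀ i, sig (c i) (j i) G ∈ WI k (j i) (kk * m i)) ∧
      p ^ e * G.totalDegree ≤ T * F.totalDegree := by
  have hq : 0 < p ^ e := pow_pos (Fact.out : p.Prime).pos _
  have hH0 : F ^ T ≠ 0 := pow_ne_zero _ hF0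
  obtain ⟨a, ha⟩ := ne_zero_iff.1 hH0
  let u : Fin (N + 1) →₀ ℕ := Finsupp.equivFunOnFinite.symm fun l => a l / p ^ e
  let v : Fin (N + 1) →₀ ℕ := Finsupp.equivFunOnFinite.symm fun l => a l % p ^ e
  have huv : a = p ^ e • u + v := by
    ext l
    simp [u, v, Nat.div_add_mod]
  obtain ⟨φ, hφ, hφ'⟩ := exists_phi (k := k) p e v (fun l => Nat.mod_lt _ hq)
  refine ⟨φ (F ^ T), ?_, ?_, ?_⟩
  · intro h
    have := hφ (F ^ T) u
    rw [h, ← huv, coeff_zero, zero_pow hq.ne'] at this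
    exact ha this.symm
  · intro i
    rcases Nat.eq_zero_or_pos (m i) with h | h
    · rw [h]; exact WI_zero _
    · refine phi_van p (p ^ e) e rfl φ hφ' (c i) (j i) (T * (r * m i)) _ ?_ _ ?_
      · generalize p ^ e = q at *
        obtain ⟨N', rfl⟩ : ∃ N', N = N' + 1 := ⟨N - 1, by omega⟩
        obtain ⟨q', rfl⟩ : ∃ q', q = q' + 1 := ⟨q - 1, by omega⟩
        have e1 : N' + 1 + kk - 1 = N' + kk := by omega
        rw [e1] at hT
        have h1 : (q' + 1) * (N' + kk) * m i ≤ r * T * m i := Nat.mul_le_mul_right _ hT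
        have h2 : (q' + 1) * N' * 1 ≤ (q' + 1) * N' * m i := Nat.mul_le_mul_left _ h
        simp only [Nat.add_sub_cancel]
        nlinarith
      · rw [map_pow]
        exact WI_pow T (hF i)
  · have hd : (F ^ T).totalDegree ≤ T * F.totalDegree := totalDegree_pow _ _
    refine le_trans ?_ hd
    rcases Nat.eq_zero_or_pos (φ (F ^ T)).totalDegree with h0 | h0
    · rw [h0]; simp
    have hle : (φ (F ^ T)).totalDegree ≤ (F ^ T).totalDegree / p ^ e := by
      refine Finset.sup_le fun b hb => ?_
      rw [Nat.le_div_iff_mul_le hq]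
      have h1 : p ^ e • b + v ∈ (F ^ T).support := by
        rw [mem_support_iff, ← hφ]
        exact pow_ne_zero _ (mem_support_iff.1 hb)
      have h2 := le_totalDegree h1
      refine le_trans ?_ h2
      rw [Finsupp.sum_fintype _ _ (by simp), Finsupp.sum_fintype _ _ (by simp)]
      rw [Finset.sum_mul]
      refine Finset.sum_le_sum fun l _ => ?_
      simp only [Finsupp.add_apply, Finsupp.smul_apply, smul_eq_mul]
      rw [mul_comm]
      omega
    rw [Nat.le_div_iff_mul_le hq] at hle
    rw [mul_comm]
    exact hle

lemma jac_int : IsJacobsonRing ℤ := by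
  rw [isJacobsonRing_iff_prime_eq]
  intro P hP
  by_cases h : P = ⊥
  · subst h
    rw [eq_bot_iff]
    intro x hx
    rw [Ideal.mem_jacobson_bot] at hx
    have h1 := hx x
    rw [Int.isUnit_iff] at h1
    rw [Ideal.mem_bot]
    rcases h1 with h1 | h1 <;> nlinarith
  · have := hP.isMaximal h
    exact Ideal.jacobson_eq_self_of_isMaximal

lemma residue {K : Type*} [Field K] (S : Finset K) :
    ∃ A : Subring K, (∀ x ∈ S, x ∈ A) ∧ ∃ (m : Ideal A) (_ : m.IsMaximal) (p : ℕ),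
      p.Prime ∧ CharP (A ⧸ m) p := by
  let A := Algebra.adjoin ℤ (S : Set K)
  have hft : Algebra.FiniteType ℤ A := (Subalgebra.fg_iff_finiteType _).1 ⟨S, rfl⟩
  obtain ⟨m, hm⟩ := Ideal.exists_maximal A
  refine ⟨A.toSubring, fun x hx => Algebra.subset_adjoin hx, m, hm, ?_⟩
  let _ : Field (A ⧸ m) := Ideal.Quotient.field m
  have := jac_int
  have hft2 : Algebra.FiniteType ℤ (A ⧸ m) :=
    Algebra.FiniteType.of_surjective (Ideal.Quotient.mkₐ ℤ m) (Ideal.Quotient.mkₐ_surjective ℤ m)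
  have hfin : Module.Finite ℤ (A ⧸ m) := finite_of_finite_type_of_isJacobsonRing ℤ (A ⧸ m)
  obtain ⟨p, hp⟩ := CharP.exists (A ⧸ m)
  refine ⟨p, ?_, hp⟩
  rcases CharP.char_is_prime_or_zero (A ⧸ m) p with h | h
  · exact h
  · subst h
    exfalso
    have : CharZero (A ⧸ m) := CharP.charP_to_charZero _
    have hint : Algebra.IsIntegral ℤ (A ⧸ m) := inferInstance
    refine Int.not_isField (isField_of_isIntegral_of_isField (R := ℤ) (S := A ⧸ m) ?_
      (Field.toIsField _))
    exact (algebraMap ℤ (A ⧸ m)).injective_int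

def Emat {R : Type*} [CommRing R] {n s : ℕ} (c : Fin s → Fin n → R) (j : Fin s → Fin n)
    (M : Fin s → ℕ) (Cnd Mon : Finset (Fin n →₀ ℕ)) : Matrix (Fin s × Cnd) Mon R :=
  fun x b => if wt (j x.1) x.2 < M x.1 then
    coeff (x.2 : Fin n →₀ ℕ) (sig (c x.1) (j x.1) (monomial b 1)) else 0

def pol {R : Type*} [CommRing R] {n : ℕ} {Mon : Finset (Fin n →₀ ℕ)} (v : Mon → R) :
    MvPolynomial (Fin n) R := ∑ b : Mon, v b • monomial (b : Fin n →₀ ℕ) (1 : R)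

lemma Emat_mulVec {R : Type*} [CommRing R] {n s : ℕ} (c : Fin s → Fin n → R) (j : Fin s → Fin n)
    (M : Fin s → ℕ) (Cnd Mon : Finset (Fin n →₀ ℕ)) (v : Mon → R) (x) :
    (Emat c j M Cnd Mon).mulVec v x = if wt (j x.1) x.2 < M x.1 then
      coeff (x.2 : Fin n →₀ ℕ) (sig (c x.1) (j x.1) (pol v)) else 0 := by
  simp only [Matrix.mulVec, dotProduct, Emat, pol]
  split_ifs
  · simp [map_sum, coeff_sum, mul_comm]
  · simp

lemma Emat_map {R S : Type*} [CommRing R] [CommRing S] (f : R →+* S) {n s : ℕ}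
    (c : Fin s → Fin n → R) (j : Fin s → Fin n)
    (M : Fin s → ℕ) (Cnd Mon : Finset (Fin n →₀ ℕ)) :
    (Emat c j M Cnd Mon).map f = Emat (fun i l => f (c i l)) j M Cnd Mon := by
  ext x b
  simp only [Emat, Matrix.map_apply]
  split_ifs
  · rw [← coeff_map, ← sig_map]; simp
  · simp

lemma coeff_pol {R : Type*} [CommRing R] {n : ℕ} {Mon : Finset (Fin n →₀ ℕ)} (v : Mon → R)
    (b : Mon) : coeff (b : Fin n →₀ ℕ) (pol v) = v b := by
  rw [pol, coeff_sum, Finset.sum_eq_single b]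
  · simp
  · intro b' _ h
    rw [coeff_smul, coeff_monomial, if_neg (fun h' => h (Subtype.ext h'))]; simp
  · simp

lemma pol_coeff {R : Type*} [CommRing R] {n : ℕ} {Mon : Finset (Fin n →₀ ℕ)}
    (G : MvPolynomial (Fin n) R) (hG : G.support ⊆ Mon) :
    pol (fun b : Mon => coeff (b : Fin n →₀ ℕ) G) = G := by
  conv_rhs => rw [G.as_sum, Finset.sum_subset hG (by
    intro x _ hx
    rw [notMem_support_iff.1 hx]; simp)]
  rw [← Finset.sum_coe_sort]
  simp [pol, smul_monomial]

universe u in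
lemma spread {K : Type u} [Field K] {n s : ℕ} (c : Fin s → Fin n → K) (j : Fin s → Fin n)
    (M M' : Fin s → ℕ) (D : ℕ)
    (hD : ∀ G : MvPolynomial (Fin n) K, G ≠ 0 → (∀ i, sig (c i) (j i) G ∈ WI K (j i) (M i)) →
      D ≤ G.totalDegree)
    (F : MvPolynomial (Fin n) K) (hF0 : F ≠ 0)
    (hF : ∀ i, sig (c i) (j i) F ∈ WI K (j i) (M' i)) :
    ∃ (A : Subring K) (m : Ideal A) (_ : m.IsMaximal) (p : ℕ) (_ : p.Prime) (_ : CharP (A ⧸ m) p)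
      (c' : Fin s → Fin n → A ⧸ m) (F' : MvPolynomial (Fin n) (A ⧸ m)),
      (∀ (B : Type u) [CommRing B] [Nontrivial B] (f : A ⧸ m →+* B) (G : MvPolynomial (Fin n) B),
        G ≠ 0 → (∀ i, sig (fun l => f (c' i l)) (j i) G ∈ WI B (j i) (M i)) →
        D ≤ G.totalDegree) ∧ F' ≠ 0 ∧
      (∀ i, sig (c' i) (j i) F' ∈ WI (A ⧸ m) (j i) (M' i)) ∧ F'.totalDegree ≤ F.totalDegree := by
  classical
  let Mon : Finset (Fin n →₀ ℕ) :=
    (Finset.range D).biUnion fun d => Finset.univ.finsuppAntidiag d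
  have hMon : ∀ a : Fin n →₀ ℕ, a ∈ Mon ↔ a.sum (fun _ e => e) < D := by
    intro a
    rw [Finsupp.sum_fintype _ _ (by simp)]
    simp [Mon]
  have hMonG : ∀ {B : Type u} [CommRing B] (G : MvPolynomial (Fin n) B), G.totalDegree < D →
      G.support ⊆ Mon := by
    intro B _ G hG a ha
    rw [hMon]
    exact lt_of_le_of_lt (le_totalDegree ha) hG
  let Cnd : Finset (Fin n →₀ ℕ) := Finset.univ.biUnion fun i =>
    Mon.biUnion fun b => (sig (c i) (j i) (monomial b (1 : K))).support
  have hCnd : ∀ i a, a ∉ Cnd → ∀ v : Mon → K, coeff a (sig (c i) (j i) (pol v)) = 0 := by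
    intro i a ha v
    rw [pol, map_sum, coeff_sum]
    refine Finset.sum_eq_zero fun b _ => ?_
    rw [map_smul, coeff_smul]
    have : coeff a (sig (c i) (j i) (monomial (b : Fin n →₀ ℕ) (1 : K))) = 0 := by
      by_contra h
      apply ha
      simp only [Cnd, Finset.mem_biUnion, Finset.mem_univ, true_and]
      exact ⟨i, b, b.2, mem_support_iff.2 h⟩
    rw [this, smul_zero]
  have hker : LinearMap.ker (Matrix.toLin' (Emat c j M Cnd Mon)) = ⊥ := by
    rw [LinearMap.ker_eq_bot']
    intro v hv
    by_contra hv0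
    have hp0 : pol v ≠ 0 := by
      intro h
      apply hv0
      ext b
      rw [← coeff_pol v b, h]; simp
    have h1 := hD (pol v) hp0 (by
      intro i a ha
      by_cases hc : a ∈ Cnd
      · have := congr_fun hv (i, ⟨a, hc⟩)
        rw [Matrix.toLin'_apply, Emat_mulVec, if_pos ha] at this
        exact this
      · exact hCnd i a hc v)
    have hDpos : 0 < D := by
      rcases Nat.eq_zero_or_pos D with h | h
      · exfalso
        apply hp0
        rw [pol, Finset.sum_eq_zero]
        intro b
        have := (hMon b).1 b.2
        omega
      · exact h
    have h2 : (pol v).totalDegree < D := by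
      rw [totalDegree, Finset.sup_lt_iff (by simpa using hDpos)]
      intro b hb
      rw [← hMon]
      by_contra hb'
      apply mem_support_iff.1 hb
      rw [pol, coeff_sum]
      refine Finset.sum_eq_zero fun b' _ => ?_
      rw [coeff_smul, coeff_monomial, if_neg, smul_zero]
      rintro rfl
      exact hb' b'.2
    omega
  obtain ⟨g, hg⟩ := LinearMap.exists_leftInverse_of_injective _ hker
  let L := LinearMap.toMatrix' g
  have hL : L * Emat c j M Cnd Mon = 1 := by
    have := congr_arg LinearMap.toMatrix' hg
    rwa [LinearMap.toMatrix'_comp, LinearMap.toMatrix'_toLin', LinearMap.toMatrix'_id] at this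
  obtain ⟨a0, ha0⟩ := ne_zero_iff.1 hF0
  let S : Finset K := (Finset.univ.image fun x : Fin s × Fin n => c x.1 x.2) ∪
    (Finset.univ.image fun x : Mon × (Fin s × Cnd) => L x.1 x.2) ∪
    (F.support.image fun a => coeff a F) ∪ {(coeff a0 F)⁻¹}
  obtain ⟨A, hSA, m, hm, p, hp, hch⟩ := residue S
  have hc : ∀ i l, c i l ∈ A := fun i l => hSA _ (by
    simp only [S, Finset.mem_union, Finset.mem_image]
    exact Or.inl (Or.inl (Or.inl ⟨(i, l), by simp, rfl⟩)))
  have hLA : ∀ x y, L x y ∈ A := fun x y => hSA _ (by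
    simp only [S, Finset.mem_union, Finset.mem_image]
    exact Or.inl (Or.inl (Or.inr ⟨(x, y), by simp, rfl⟩)))
  have hFA : ∀ a, coeff a F ∈ A := fun a => by
    by_cases h : coeff a F = 0
    · rw [h]; exact A.zero_mem
    · refine hSA _ ?_
      simp only [S, Finset.mem_union, Finset.mem_image]
      exact Or.inl (Or.inr ⟨a, mem_support_iff.2 h, rfl⟩)
  have hinv : (coeff a0 F)⁻¹ ∈ A := hSA _ (by simp [S])
  let cA : Fin s → Fin n → A := fun i l => ⟨c i l, hc i l⟩
  let LA : Matrix Mon (Fin s × Cnd) A := fun x y => ⟨L x y, hLA x y⟩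
  have hιinj : Function.Injective A.subtype := Subtype.val_injective
  obtain ⟨FA, hFA'⟩ : ∃ FA : MvPolynomial (Fin n) A, map A.subtype FA = F := by
    refine ⟨∑ a ∈ F.support, monomial a ⟨coeff a F, hFA a⟩, ?_⟩
    rw [map_sum]
    conv_rhs => rw [F.as_sum]
    simp
  have hLEA : LA * Emat cA j M Cnd Mon = 1 := by
    apply Matrix.map_injective hιinj
    beta_reduce
    rw [Matrix.map_mul, Emat_map, Matrix.map_one _ (map_zero _) (map_one _)]
    exact hL
  let π := Ideal.Quotient.mk m
  refine ⟨A, m, hm, p, hp, hch, fun i l => π (cA i l), map π FA, ?_, ?_, ?_, ?_⟩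
  · intro B _ _ f G hG0 hG
    by_contra hlt
    push Not at hlt
    apply hG0
    have hLE : LA.map (f.comp π) * Emat (fun i l => f (π (cA i l))) j M Cnd Mon = 1 := by
      have := congr_arg (fun X => X.map (f.comp π)) hLEA
      beta_reduce at this
      rw [Matrix.map_mul, Emat_map, Matrix.map_one _ (map_zero _) (map_one _)] at this
      exact this
    let v : Mon → B := fun b => coeff (b : Fin n →₀ ℕ) G
    have hv : pol v = G := pol_coeff G (hMonG G hlt)
    have hE : (Emat (fun i l => f (π (cA i l))) j M Cnd Mon).mulVec v = 0 := by
      ext x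
      rw [Emat_mulVec, hv]
      split_ifs with h
      · exact hG x.1 _ h
      · rfl
    have hv0 : v = 0 := by
      rw [← Matrix.one_mulVec v, ← hLE, ← Matrix.mulVec_mulVec, hE, Matrix.mulVec_zero]
    rw [← hv, hv0]
    simp [pol]
  · intro h
    have h1 : π (coeff a0 FA) = 0 := by rw [← coeff_map, h, coeff_zero]
    have h2 : coeff a0 FA * ⟨(coeff a0 F)⁻¹, hinv⟩ = 1 := by
      apply hιinj
      rw [map_mul, ← coeff_map, hFA']
      simpa using mul_inv_cancel₀ ha0
    have h3 := congr_arg π h2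
    rw [map_mul, h1, zero_mul, map_one] at h3
    exact zero_ne_one h3
  · intro i a ha
    rw [sig_map, coeff_map]
    have : coeff a (sig (cA i) (j i) FA) = 0 := by
      apply hιinj
      rw [← coeff_map, ← sig_map, hFA', map_zero]
      exact hF i a ha
    rw [this, map_zero]
  · refine Finset.sup_mono ?_
    intro a ha
    rw [mem_support_iff] at ha ⊢
    rw [coeff_map] at ha
    intro h
    apply ha
    have : coeff a FA = 0 := by
      apply hιinj
      rw [← coeff_map, hFA', h, map_zero]
    rw [this, map_zero]

lemma mem_symb {K : Type*} [Field K] [Infinite K] {n s : ℕ} (p : Fin s → Fin n → K)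
    (j : Fin s → Fin n) (hj : ∀ i, p i (j i) ≠ 0) (m : Fin s → ℕ) (k : ℕ)
    (F : MvPolynomial (Fin n) K) :
    F ∈ symbPow K p m k ↔
      ∀ i, sig (fun l => p i l / p i (j i)) (j i) F ∈ WI K (j i) (k * m i) := by
  simp only [symbPow, fatIdeal, Ideal.mem_iInf]
  exact forall_congr' fun i => cone_pow (p i) (j i) (hj i) _ F

lemma alpha_set {K : Type*} [Field K] {n : ℕ} (I : Ideal (MvPolynomial (Fin n) K)) (t : ℕ) :
    homComp K I t ≠ ⊥ ↔ ∃ F, F ≠ 0 ∧ F ∈ I ∧ F.IsHomogeneous t := by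
  rw [Submodule.ne_bot_iff]
  constructor
  · rintro ⟨F, hF, h0⟩
    exact ⟨F, h0, hF.1, hF.2⟩
  · rintro ⟨F, h0, h1, h2⟩
    exact ⟨F, ⟨h1, h2⟩, h0⟩

lemma alpha_le {K : Type*} [Field K] [Infinite K] {n s : ℕ} (p : Fin s → Fin n → K)
    (j : Fin s → Fin n) (hj : ∀ i, p i (j i) ≠ 0) (m : Fin s → ℕ) (k : ℕ)
    (G : MvPolynomial (Fin n) K) (hG0 : G ≠ 0)
    (hG : ∀ i, sig (fun l => p i l / p i (j i)) (j i) G ∈ WI K (j i) (k * m i)) :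
    (∃ F, F ≠ 0 ∧ F ∈ symbPow K p m k ∧ F.IsHomogeneous (alphaDeg K (symbPow K p m k))) ∧
    alphaDeg K (symbPow K p m k) ≤ G.totalDegree := by
  obtain ⟨a, ha⟩ := ne_zero_iff.1 hG0
  have hmem : a.degree ∈ {t : ℕ | homComp K (symbPow K p m k) t ≠ ⊥} := by
    refine (alpha_set _ _).2 ⟨homogeneousComponent a.degree G, ?_, ?_, ?_⟩
    · rw [ne_zero_iff]
      exact ⟨a, by rwa [coeff_homogeneousComponent, if_pos rfl]⟩
    · rw [mem_symb p j hj]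
      exact fun i => sig_comp _ _ (hG i) _
    · exact homogeneousComponent_isHomogeneous _ _
  constructor
  · exact (alpha_set _ _).1 (Nat.sInf_mem ⟨_, hmem⟩)
  · refine (Nat.sInf_le hmem).trans ?_
    have := le_totalDegree (mem_support_iff.2 ha)
    exact this

lemma exists_elt {K : Type*} [Field K] {N s : ℕ} (hN : 1 ≤ N) (c : Fin s → Fin (N + 1) → K)
    (j : Fin s → Fin (N + 1)) (M : Fin s → ℕ) :
    ∃ G : MvPolynomial (Fin (N + 1)) K, G ≠ 0 ∧ ∀ i, sig (c i) (j i) G ∈ WI K (j i) (M i) := by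
  have : Nontrivial (Fin (N + 1)) := Fin.nontrivial_iff_two_le.2 (by omega)
  choose l hl using fun i => exists_ne (j i)
  refine ⟨∏ i, sig (-(c i)) (j i) (X (l i)) ^ M i, ?_, ?_⟩
  · refine Finset.prod_ne_zero_iff.2 fun i _ => pow_ne_zero _ fun h => ?_
    have := congr_arg (sig (c i) (j i)) h
    rw [sig_neg', map_zero] at this
    exact X_ne_zero _ this
  · intro i
    rw [← Finset.mul_prod_erase Finset.univ _ (Finset.mem_univ i), map_mul, map_pow, sig_neg']
    refine Ideal.mul_mem_right _ _ ?_
    have hX : (X (l i) : MvPolynomial (Fin (N + 1)) K) ∈ WI K (j i) 1 := by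
      intro b hb
      rw [coeff_X, if_neg]
      rintro rfl
      have h1 : (Finsupp.single (l i) 1 : Fin (N + 1) →₀ ℕ) (l i) ≤
          wt (j i) (Finsupp.single (l i) 1) :=
        Finset.single_le_sum (f := fun x => (Finsupp.single (l i) 1 : Fin (N + 1) →₀ ℕ) x)
          (fun _ _ => Nat.zero_le _) (by simp [hl i])
      simp at h1
      omega
    simpa using WI_pow (M i) hX

lemma key {K : Type*} [Field K] [Infinite K] {N s : ℕ} (hN : 1 ≤ N) (p : Fin s → Fin (N + 1) → K)
    (hp : ∀ i, p i ≠ 0) (m : Fin s → ℕ) (k r : ℕ) (hr : 0 < r) :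
    r * alphaDeg K (symbPow K p m k) ≤ (N + k - 1) * alphaDeg K (symbPow K p m r) := by
  choose j hj using fun i => Function.ne_iff.1 (hp i)
  simp only [Pi.zero_apply] at hj
  let c : Fin s → Fin (N + 1) → K := fun i l => p i l / p i (j i)
  obtain ⟨G0, hG0, hG0'⟩ := exists_elt hN c j (fun i => r * m i)
  obtain ⟨⟨F, hF0, hFm, hFh⟩, -⟩ := alpha_le p j hj m r G0 hG0 hG0'
  rw [mem_symb p j hj] at hFm
  obtain ⟨A, I, hI, q, hq, hch, c', F', hD', hF0', hF', hdeg⟩ := spread c j (fun i => k * m i)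
    (fun i => r * m i) (alphaDeg K (symbPow K p m k))
    (fun G hG hG' => (alpha_le p j hj m k G hG hG').2) F hF0 hFm
  let _ : Field (A ⧸ I) := Ideal.Quotient.field I
  let B := AlgebraicClosure (A ⧸ I)
  let f : A ⧸ I →+* B := algebraMap _ _
  have : Fact q.Prime := ⟨hq⟩
  have : CharP B q := charP_of_injective_algebraMap f.injective q
  have hFB0 : map f F' ≠ 0 := by
    rw [← map_zero (map f)]
    exact fun h => hF0' (map_injective f f.injective h)
  have hFB : ∀ i, sig (fun l => f (c' i l)) (j i) (map f F') ∈ WI B (j i) (r * m i) := by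
    intro i a ha
    rw [sig_map, coeff_map, hF' i a ha, map_zero]
  have hFd : (map f F').totalDegree ≤ alphaDeg K (symbPow K p m r) := by
    refine le_trans ?_ (hdeg.trans hFh.totalDegree_le)
    exact Finset.sup_mono (support_map_subset _ _)
  generalize alphaDeg K (symbPow K p m r) = d at *
  generalize alphaDeg K (symbPow K p m k) = α at *
  by_contra hlt
  push Not at hlt
  have hbound : ∀ e : ℕ, q ^ e ≤ d * r := by
    intro e
    obtain ⟨G, hG, hG', hGd⟩ := main_charp q hN (fun i l => f (c' i l)) j m r k e
      (q ^ e * (N + k - 1) / r + 1) (by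
        have := Nat.lt_mul_div_succ (q ^ e * (N + k - 1)) hr
        omega) (map f F') hFB0 hFB
    have h1 := hD' B f G hG hG'
    have h2 : q ^ e * α ≤ (q ^ e * (N + k - 1) / r + 1) * d :=
      (Nat.mul_le_mul_left _ h1).trans (hGd.trans (Nat.mul_le_mul_left _ hFd))
    have h3 : r * (q ^ e * (N + k - 1) / r) ≤ q ^ e * (N + k - 1) := Nat.mul_div_le _ _
    generalize q ^ e * (N + k - 1) / r = w at *
    generalize N + k - 1 = y at *
    generalize q ^ e = Q at *
    have h4 : Q * ((y * d) + 1) ≤ Q * (r * α) := Nat.mul_le_mul_left _ hlt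
    have h5 : r * (Q * α) ≤ r * ((w + 1) * d) := Nat.mul_le_mul_left _ h2
    have h6 : r * w * d ≤ Q * y * d := Nat.mul_le_mul_right _ h3
    nlinarith
  have := hbound (d * r)
  have h2 := Nat.lt_pow_self hq.one_lt (n := d * r)
  omega

end WS

set_option maxHeartbeats 1000000 in
/-- For a nonzero fat point subscheme `Z ⊆ ℙ^N` and every positive integer `k`:
`α(I(kZ))/(N+k−1) ≤ α̂(I(Z)) ≤ α(I(kZ))/k`.  In particular (for `k = 1`),
`α(I(Z))/N ≤ α̂(I(Z))` (the Waldschmidt–Skoda bound). -/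
theorem waldschmidt_skoda_bounds (K : Type*) [Field K] [IsAlgClosed K]
    (N s : ℕ) (hN : 1 ≤ N)
    (p : Fin s → (Fin (N + 1) → K)) (hp : ProjDistinct K p)
    (m : Fin s → ℕ) (hm : ∃ i, 0 < m i) :
    (∀ k : ℕ, 0 < k →
      (alphaDeg K (symbPow K p m k) : ℝ) / ((N : ℝ) + (k : ℝ) - 1) ≤ waldschmidt K p m ∧
      waldschmidt K p m ≤ (alphaDeg K (symbPow K p m k) : ℝ) / (k : ℝ)) ∧
    (alphaDeg K (fatIdeal K p m) : ℝ) / (N : ℝ) ≤ waldschmidt K p m := by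

  have hinf : Infinite K := IsAlgClosed.instInfinite
  have hbdd : BddBelow (Set.range fun k : ℕ+ =>
      (alphaDeg K (symbPow K p m k) : ℝ) / ((k : ℕ) : ℝ)) := by
    refine ⟨0, ?_⟩
    rintro _ ⟨k, rfl⟩
    positivity
  have hlow : ∀ k : ℕ, 0 < k →
      (alphaDeg K (symbPow K p m k) : ℝ) / ((N : ℝ) + (k : ℝ) - 1) ≤ waldschmidt K p m := by
    intro k hk
    refine le_ciInf fun r => ?_
    have hr : (0 : ℝ) < ((r : ℕ) : ℝ) := by exact_mod_cast r.pos
    have h1 := WS.key hN p hp.1 m k r r.pos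
    have h2 : ((N + k - 1 : ℕ) : ℝ) = (N : ℝ) + (k : ℝ) - 1 := by
      rw [Nat.cast_sub (by omega)]; push_cast; ring
    have h3 : (0 : ℝ) < (N : ℝ) + (k : ℝ) - 1 := by
      rw [← h2]
      exact_mod_cast (by omega : 0 < N + k - 1)
    rw [div_le_div_iff₀ h3 hr, ← h2]
    have h4 : ((r : ℕ) : ℝ) * alphaDeg K (symbPow K p m k) ≤
      ((N + k - 1 : ℕ) : ℝ) * alphaDeg K (symbPow K p m r) := by exact_mod_cast h1
    linarith
  refine ⟨fun k hk => ⟨hlow k hk, ?_⟩, ?_⟩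
  · exact ciInf_le hbdd ⟨k, hk⟩
  · have h := hlow 1 one_pos
    have he : symbPow K p m 1 = fatIdeal K p m := by simp [symbPow]
    rw [he] at h
    simpa using h

end
end

section
/- Let Z = m_1p_1+⋯+m_sp_s be a nonzero fat point subscheme of ℙ^N. Then α̂(I(Z)) ≤ (Σ_i m_i^N)^{1/N}. -/
open MvPolynomial

noncomputable section

/-- exponents of degree `t` in `N+1` variables -/
abbrev expo (N t : ℕ) : Finset (Fin (N + 1) →₀ ℕ) := Finset.finsuppAntidiag Finset.univ t

lemma mem_expo {N t : ℕ} (d : Fin (N + 1) →₀ ℕ) : d ∈ expo N t ↔ ∑ i, d i = t := by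
  simp [expo, Finset.mem_finsuppAntidiag]

lemma card_expo (N t : ℕ) : Fintype.card (expo N t) = (t + N).choose N := by
  rw [Fintype.card_coe, Finset.card_finsuppAntidiag_nat_eq_choose]
  simp only [Finset.card_univ, Fintype.card_fin]
  have : N + 1 + t - 1 = t + N := by omega
  rw [this, Nat.choose_symm_add]

/-- coordinate change -/
def shiftHom (K : Type*) [Field K] {n : ℕ} (j : Fin n) (c : Fin n → K) :
    MvPolynomial (Fin n) K →ₐ[K] MvPolynomial (Fin n) K :=
  aeval (fun i => if i = j then X j else X i + C (c i) * X j)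

lemma shift_shift (K : Type*) [Field K] {n : ℕ} (j : Fin n) (c : Fin n → K)
    (f : MvPolynomial (Fin n) K) :
    shiftHom K j (fun i => - c i) (shiftHom K j c f) = f := by
  have : (shiftHom K j (fun i => - c i)).comp (shiftHom K j c) = AlgHom.id K _ := by
    ext1 i
    by_cases h : i = j
    · simp [shiftHom, h]
    · simp [shiftHom, h]
  exact congrArg (fun g => g f) this

lemma shift_homog (K : Type*) [Field K] {n : ℕ} (j : Fin n) (c : Fin n → K)
    (f : MvPolynomial (Fin n) K) {t : ℕ} (hf : f.IsHomogeneous t) :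
    (shiftHom K j c f).IsHomogeneous t := by
  have := hf.aeval (fun i => if i = j then X j else X i + C (c i) * X j) (n := 1) (by
    intro i
    split_ifs
    · exact isHomogeneous_X _ _
    · exact (isHomogeneous_X _ _).add (by
        simpa using (isHomogeneous_C (Fin n) (c i)).mul (isHomogeneous_X K j)))
  simpa [shiftHom] using this

lemma mem_cone_pow (K : Type*) [Field K] {N : ℕ} (p : Fin (N + 1) → K) (j : Fin (N + 1))
    (hj : p j ≠ 0) (t k : ℕ) (f : MvPolynomial (Fin (N + 1)) K) (hf : f.IsHomogeneous t)
    (h : ∀ e ∈ expo N k, coeff (e.update j (t - (k - e j))) (shiftHom K j (fun i => p i / p j) f) = 0) :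
    f ∈ coneIdeal K p ^ k := by
  set g := shiftHom K j (fun i => p i / p j) f with hg
  have hgh : g.IsHomogeneous t := shift_homog K j _ f hf
  rw [← shift_shift K j (fun i => p i / p j) f, ← hg, g.as_sum, map_sum]
  refine Ideal.sum_mem _ fun d hd => ?_
  have hdt : ∑ i, d i = t := by
    have := hgh (mem_support_iff.1 hd)
    rw [← this, Finsupp.weight_apply, Finsupp.sum_fintype] <;> simp
  have hsplit : d j + ∑ i ∈ Finset.univ.erase j, d i = t := by
    rw [Finset.add_sum_erase _ _ (Finset.mem_univ j), hdt]
  have hk : k ≤ ∑ i ∈ Finset.univ.erase j, d i := by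
    by_contra! hlt
    set r := ∑ i ∈ Finset.univ.erase j, d i with hr
    apply mem_support_iff.1 hd
    have := h (d.update j (k - r)) (by
      rw [mem_expo, ← Finset.add_sum_erase _ _ (Finset.mem_univ j)]
      have : ∑ i ∈ Finset.univ.erase j, (d.update j (k - r)) i = r := by
        rw [hr]
        refine Finset.sum_congr rfl fun i hi => ?_
        simp [Finsupp.update_apply, Finset.ne_of_mem_erase hi]
      rw [this]
      simp
      omega)
    convert this using 2
    ext i
    by_cases hi : i = j
    · subst hi
      simp
      omega
    · simp [Finsupp.update_apply, hi]
  rw [monomial_eq, map_mul]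
  refine Ideal.mul_mem_left _ _ ?_
  rw [Finsupp.prod_fintype _ _ (by simp), map_prod,
    ← Finset.mul_prod_erase _ _ (Finset.mem_univ j)]
  refine Ideal.mul_mem_left _ _ (Ideal.pow_le_pow_right hk ?_)
  rw [← Finset.prod_pow_eq_pow_sum]
  refine Ideal.prod_mem_prod fun i hi => ?_
  rw [map_pow]
  refine Ideal.pow_mem_pow ?_ _
  have hij := Finset.ne_of_mem_erase hi
  intro a
  simp [shiftHom, hij]
  field_simp
  ring

lemma exists_form (K : Type*) [Field K] {N s : ℕ} (p : Fin s → (Fin (N + 1) → K))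
    (hp : ∀ i, p i ≠ 0) (m : Fin s → ℕ) (t : ℕ)
    (h : ∑ i, (m i + N).choose N < (t + N).choose N) :
    homComp K (fatIdeal K p m) t ≠ ⊥ := by
  choose j hj using fun i => Function.ne_iff.1 (hp i)
  let F : (expo N t → K) →ₗ[K] MvPolynomial (Fin (N + 1)) K :=
    ∑ d : expo N t, (monomial d.1).comp (LinearMap.proj d)
  have hFc : ∀ v (d : expo N t), coeff d.1 (F v) = v d := by
    intro v d
    simp [F, coeff_sum, coeff_monomial, Subtype.coe_inj]
  have hFh : ∀ v, (F v).IsHomogeneous t := by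
    intro v
    simp only [F, LinearMap.sum_apply]
    refine IsHomogeneous.sum _ _ _ fun d _ => ?_
    refine isHomogeneous_monomial _ ?_
    have := (mem_expo d.1).1 d.2
    rw [Finsupp.degree_eq_sum, this]
  let G : (expo N t → K) →ₗ[K] ((Σ i : Fin s, expo N (m i)) → K) :=
    LinearMap.pi fun x => (lcoeff K (x.2.1.update (j x.1) (t - (m x.1 - x.2.1 (j x.1))))).comp
      ((shiftHom K (j x.1) (fun i => p x.1 i / p x.1 (j x.1))).toLinearMap.comp F)
  have hker : LinearMap.ker G ≠ ⊥ := by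
    apply LinearMap.ker_ne_bot_of_finrank_lt
    rw [Module.finrank_fintype_fun_eq_card, Module.finrank_fintype_fun_eq_card,
      Fintype.card_sigma, card_expo]
    simpa only [card_expo] using h
  obtain ⟨v, hv, hv0⟩ := (Submodule.ne_bot_iff _).1 hker
  refine (Submodule.ne_bot_iff _).2 ⟨F v, ⟨?_, hFh v⟩, ?_⟩
  · change F v ∈ fatIdeal K p m
    rw [fatIdeal, Ideal.mem_iInf]
    intro i
    refine mem_cone_pow K (p i) (j i) (hj i) t (m i) (F v) (hFh v) fun e he => ?_
    exact congrFun (LinearMap.mem_ker.1 hv) ⟨i, e, he⟩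
  · intro h0
    apply hv0
    ext d
    rw [← hFc v d, h0]
    simp

lemma choose_lt {N s : ℕ} (m : Fin s → ℕ) (t : ℕ)
    (h : ∑ i, (m i + N) ^ N < (t + 1) ^ N) :
    ∑ i, (m i + N).choose N < (t + N).choose N := by
  refine lt_of_mul_lt_mul_left (a := N.factorial) ?_ (Nat.zero_le _)
  rw [Finset.mul_sum]
  simp only [← Nat.descFactorial_eq_factorial_mul_choose]
  calc _ ≤ ∑ i, (m i + N) ^ N := Finset.sum_le_sum fun i _ => Nat.descFactorial_le_pow _ _
    _ < (t + 1) ^ N := h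
    _ ≤ _ := by
      have := Nat.pow_sub_le_descFactorial (t + N) N
      rwa [show t + N + 1 - N = t + 1 by omega] at this

lemma alpha_le (K : Type*) [Field K] {N s : ℕ} (hN : 1 ≤ N) (p : Fin s → (Fin (N + 1) → K))
    (hp : ∀ i, p i ≠ 0) (m : Fin s → ℕ) :
    (alphaDeg K (fatIdeal K p m) : ℝ) ≤ (∑ i, ((m i : ℝ) + N) ^ N) ^ ((1 : ℝ) / (N : ℝ)) := by
  set S : ℝ := ∑ i, ((m i : ℝ) + N) ^ N with hS
  have hS0 : 0 ≤ S := Finset.sum_nonneg fun i _ => by positivity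
  have hr0 : 0 ≤ S ^ ((1 : ℝ) / (N : ℝ)) := Real.rpow_nonneg hS0 _
  refine le_trans ?_ (Nat.floor_le hr0)
  have hlt := Nat.lt_floor_add_one (S ^ ((1 : ℝ) / (N : ℝ)))
  set t := ⌊S ^ ((1 : ℝ) / (N : ℝ))⌋₊
  refine Nat.cast_le.2 (Nat.sInf_le ?_)
  refine exists_form K p hp m t (choose_lt m t ?_)
  have h2 : S < ((t : ℝ) + 1) ^ N := by
    have := pow_lt_pow_left₀ hlt hr0 (n := N) (by omega)
    rwa [one_div, Real.rpow_inv_natCast_pow hS0 (by omega)] at this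
  rw [hS] at h2
  exact_mod_cast h2

set_option maxHeartbeats 1000000 in
/-- For a nonzero fat point subscheme `Z = m_1 p_1 + ⋯ + m_s p_s ⊆ ℙ^N`,
`α̂(I(Z)) ≤ (Σ_i m_i^N)^{1/N}`. -/
theorem waldschmidt_upper_bound (K : Type*) [Field K] [IsAlgClosed K]
    (N s : ℕ) (hN : 1 ≤ N)
    (p : Fin s → (Fin (N + 1) → K)) (hp : ProjDistinct K p)
    (m : Fin s → ℕ) (hm : ∃ i, 0 < m i) :
    waldschmidt K p m ≤ (∑ i, (m i : ℝ) ^ N) ^ ((1 : ℝ) / (N : ℝ)) := by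
  have key : ∀ k : ℕ, 0 < k → waldschmidt K p m ≤
      (∑ i, ((m i : ℝ) + N / (k : ℝ)) ^ N) ^ ((1 : ℝ) / (N : ℝ)) := by
    intro k hk
    have hk' : (0 : ℝ) < k := by exact_mod_cast hk
    have h1 : waldschmidt K p m ≤ (alphaDeg K (symbPow K p m k) : ℝ) / (k : ℝ) :=
      ciInf_le (f := fun k : ℕ+ => (alphaDeg K (symbPow K p m k) : ℝ) / (k : ℝ))
        ⟨0, by rintro _ ⟨x, rfl⟩; positivity⟩ ⟨k, hk⟩
    refine h1.trans ?_
    rw [div_le_iff₀ hk']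
    refine (alpha_le K hN p hp.1 (fun i => k * m i)).trans (le_of_eq ?_)
    have h3 : ∑ i, (((k * m i : ℕ) : ℝ) + N) ^ N
        = (∑ i, ((m i : ℝ) + N / (k : ℝ)) ^ N) * (k : ℝ) ^ N := by
      rw [Finset.sum_mul]
      refine Finset.sum_congr rfl fun i _ => ?_
      rw [← mul_pow]
      congr 1
      push_cast
      field_simp
    rw [h3, Real.mul_rpow (Finset.sum_nonneg fun i _ => by positivity) (by positivity),
      one_div, Real.pow_rpow_inv_natCast hk'.le (by omega)]
  have hlim : Filter.Tendsto
      (fun k : ℕ => (∑ i, ((m i : ℝ) + N / (k : ℝ)) ^ N) ^ ((1 : ℝ) / (N : ℝ)))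
      Filter.atTop (nhds ((∑ i, ((m i : ℝ) + 0) ^ N) ^ ((1 : ℝ) / (N : ℝ)))) := by
    refine Filter.Tendsto.rpow_const ?_ (Or.inr (by positivity))
    refine tendsto_finsetSum _ fun i _ => ?_
    exact (tendsto_const_nhds.add (tendsto_const_div_atTop_nhds_zero_nat (N : ℝ))).pow N
  simp only [add_zero] at hlim
  exact ge_of_tendsto hlim (Filter.eventually_atTop.2 ⟨1, fun k hk => key k hk⟩)

end
end
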